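/- arXiv:2306.11625 — 3 statements merged into one kernel-verified Lean document; each statement's English description precedes it below -/
import Mathlib

section
/- For every y > 0, the quantity 1/y² − 1/(sinh y)² satisfies 0 < 1/y² − 1/(sinh y)² ≤ 1/3. -/
theorem nonneg_of_hasDerivAt_nonneg_of_zero {f f' : ℝ → ℝ} (hf : ∀ x, HasDerivAt f (f' x) x)
    (h0 : f 0 = 0) (hf' : ∀ x, 0 ≤ x → 0 ≤ f' x) (x : ℝ) (hx : 0 ≤ x) : 0 ≤ f x := by
  have hmono : MonotoneOn f (Set.Ici 0) := by
    refine monotoneOn_of_hasDerivWithinAt_nonneg (convex_Ici 0)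
      (fun x _ => (hf x).continuousAt.continuousWithinAt)
      (fun x _ => (hf x).hasDerivWithinAt) fun x hx => hf' x ?_
    exact interior_subset hx
  exact h0 ▸ hmono Set.self_mem_Ici hx hx

theorem Real.sinh_le_self_mul_cosh (x : ℝ) (hx : 0 ≤ x) : Real.sinh x ≤ x * Real.cosh x := by
  refine sub_nonneg.mp (nonneg_of_hasDerivAt_nonneg_of_zero
    (f := fun x => x * Real.cosh x - Real.sinh x) (f' := fun x => x * Real.sinh x)
    (fun x => ?_) (by simp) (fun x hx => mul_nonneg hx (Real.sinh_nonneg_iff.mpr hx)) x hx)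
  exact (((hasDerivAt_id' x).mul (Real.hasDerivAt_cosh x)).sub
    (Real.hasDerivAt_sinh x)).congr_deriv (by ring)

theorem Real.six_mul_sq_add_mul_cosh_sub_one_nonneg (x : ℝ) (hx : 0 ≤ x) :
    0 ≤ 6 * x ^ 2 + (x ^ 2 - 12) * (Real.cosh x - 1) := by
  have hsq (x : ℝ) : HasDerivAt (fun x : ℝ => x ^ 2) (2 * x) x := by
    simpa using hasDerivAt_pow 2 x
  have hthird (x : ℝ) (hx : 0 ≤ x) :
      0 ≤ 6 * (x * Real.cosh x - Real.sinh x) + x ^ 2 * Real.sinh x := by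
    have := Real.sinh_le_self_mul_cosh x hx
    have := mul_nonneg (sq_nonneg x) (Real.sinh_nonneg_iff.mpr hx)
    linarith
  have hsecond := nonneg_of_hasDerivAt_nonneg_of_zero
    (f := fun x => 10 * (1 - Real.cosh x) + 4 * (x * Real.sinh x) + x ^ 2 * Real.cosh x)
    (fun x => ((((Real.hasDerivAt_cosh x).const_sub 1).const_mul 10).add
      (((hasDerivAt_id' x).mul (Real.hasDerivAt_sinh x)).const_mul 4)).add
      ((hsq x).mul (Real.hasDerivAt_cosh x)) |>.congr_deriv (by ring)) (by simp) hthird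
  have hfirst := nonneg_of_hasDerivAt_nonneg_of_zero
    (f := fun x => 10 * x + 2 * (x * Real.cosh x) + (x ^ 2 - 12) * Real.sinh x)
    (fun x => (((hasDerivAt_id' x).const_mul 10).add
      (((hasDerivAt_id' x).mul (Real.hasDerivAt_cosh x)).const_mul 2)).add
      (((hsq x).sub_const 12).mul (Real.hasDerivAt_sinh x)) |>.congr_deriv (by ring))
    (by simp) hsecond
  exact nonneg_of_hasDerivAt_nonneg_of_zero
    (f := fun x => 6 * x ^ 2 + (x ^ 2 - 12) * (Real.cosh x - 1))
    (fun x => ((hsq x).const_mul 6).add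
      (((hsq x).sub_const 12).mul ((Real.hasDerivAt_cosh x).sub_const 1))
      |>.congr_deriv (by ring)) (by simp) hfirst x hx

/-- For every `y > 0`, `0 < 1/y² − 1/(sinh y)² ≤ 1/3`. -/
theorem inv_sq_sub_inv_sinh_sq_bounds (y : ℝ) (hy : 0 < y) :
    0 < 1 / y ^ 2 - 1 / (Real.sinh y) ^ 2 ∧ 1 / y ^ 2 - 1 / (Real.sinh y) ^ 2 ≤ 1 / 3 := by
  have hs : 0 < Real.sinh y := Real.sinh_pos_iff.mpr hy
  constructor
  · have hlt : y < Real.sinh y := Real.self_lt_sinh_iff.mpr hy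
    exact sub_pos.mpr (one_div_lt_one_div_of_lt (by positivity) (by gcongr))
  · have h := Real.six_mul_sq_add_mul_cosh_sub_one_nonneg (2 * y) (by positivity)
    rw [Real.cosh_two_mul, Real.cosh_sq] at h
    rw [div_sub_div _ _ (by positivity) (by positivity), div_le_div_iff₀ (by positivity)
      (by norm_num)]
    linarith
end

section
/- For every β > 0, every ξ ∈ ℝ³ \ {0} and every x ∈ ℝ³, the matrix F̃(ξ) is uniformly bounded: ‖F̃(ξ) x‖ ≤ (β/3)·‖x‖, where ‖·‖ denotes the Euclidean norm. -/
open MeasureTheory Filter Matrix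
open scoped Topology

/-- The hyperbolic cotangent `coth y = cosh y / sinh y`. -/
noncomputable def coth (y : ℝ) : ℝ := Real.cosh y / Real.sinh y

/-- The dilated Langevin function `L_β`: `L_β z = coth (β z) - 1/(β z)` for `z ≠ 0`, `L_β 0 = 0`. -/
noncomputable def Lb (β z : ℝ) : ℝ := if z = 0 then 0 else coth (β * z) - 1 / (β * z)

/-- `L'_β z = 1/(β z²) - β/(sinh (β z))²` (the derivative of `L_β` away from `0`). -/
noncomputable def Lb' (β z : ℝ) : ℝ := 1 / (β * z ^ 2) - β / (Real.sinh (β * z)) ^ 2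

/-- The Euclidean norm on `ℝ³`. -/
noncomputable def enorm3 (ξ : Fin 3 → ℝ) : ℝ := Real.sqrt (∑ i, ξ i ^ 2)

/-- The matrix `F̃(ξ) = (L'_β(‖ξ‖)/‖ξ‖² − L_β(‖ξ‖)/‖ξ‖³)·ξξᵀ + (L_β(‖ξ‖)/‖ξ‖)·I₃` for `ξ ≠ 0`,
extended to `ξ = 0` by `(β/3)·I₃`. -/
noncomputable def Ftilde (β : ℝ) (ξ : Fin 3 → ℝ) : Matrix (Fin 3) (Fin 3) ℝ :=
  if ξ = 0 then (β / 3) • (1 : Matrix (Fin 3) (Fin 3) ℝ)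
  else (Lb' β (enorm3 ξ) / (enorm3 ξ) ^ 2 - Lb β (enorm3 ξ) / (enorm3 ξ) ^ 3) •
        Matrix.of (fun i j => ξ i * ξ j)
      + (Lb β (enorm3 ξ) / enorm3 ξ) • (1 : Matrix (Fin 3) (Fin 3) ℝ)

/-- A function vanishing at `0` with nonnegative derivative on `[0, ∞)` is nonnegative there. -/
lemma nonneg_of_hasDerivAt_nonneg {f f' : ℝ → ℝ} (h0 : f 0 = 0)
    (hf : ∀ x, HasDerivAt f (f' x) x) (hf' : ∀ x, 0 ≤ x → 0 ≤ f' x) {y : ℝ} (hy : 0 ≤ y) :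
    0 ≤ f y := by
  have hmono : MonotoneOn f (Set.Ici 0) :=
    monotoneOn_of_hasDerivWithinAt_nonneg (convex_Ici 0)
      (fun x _ => (hf x).continuousAt.continuousWithinAt)
      (fun x _ => (hf x).hasDerivWithinAt)
      (fun x hx => hf' x (interior_subset hx))
  exact h0 ▸ hmono Set.self_mem_Ici hy hy

lemma sinh_le_mul_cosh {y : ℝ} (hy : 0 ≤ y) : Real.sinh y ≤ y * Real.cosh y := by
  refine sub_nonneg.1 (nonneg_of_hasDerivAt_nonneg
    (f := fun x => x * Real.cosh x - Real.sinh x) (f' := fun x => x * Real.sinh x)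
    (by simp) (fun x => ?_) (fun x hx => mul_nonneg hx (Real.sinh_nonneg_iff.2 hx)) hy)
  refine (((hasDerivAt_id x).mul (Real.hasDerivAt_cosh x)).sub (Real.hasDerivAt_sinh x)).congr_deriv ?_
  simp

lemma mul_cosh_sub_sinh_le {y : ℝ} (hy : 0 ≤ y) :
    3 * (y * Real.cosh y - Real.sinh y) ≤ y ^ 2 * Real.sinh y := by
  refine sub_nonneg.1 (nonneg_of_hasDerivAt_nonneg
    (f := fun x => x ^ 2 * Real.sinh x - 3 * (x * Real.cosh x - Real.sinh x))
    (f' := fun x => x * (x * Real.cosh x - Real.sinh x))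
    (by simp) (fun x => ?_)
    (fun x hx => mul_nonneg hx (sub_nonneg.2 (sinh_le_mul_cosh hx))) hy)
  refine (((hasDerivAt_pow 2 x).mul (Real.hasDerivAt_sinh x)).sub
    ((((hasDerivAt_id x).mul (Real.hasDerivAt_cosh x)).sub
      (Real.hasDerivAt_sinh x)).const_mul 3)).congr_deriv ?_
  simp
  ring

lemma two_mul_cosh_le {y : ℝ} (hy : 0 ≤ y) : 2 * Real.cosh y ≤ y * Real.sinh y + 2 := by
  refine sub_nonneg.1 (nonneg_of_hasDerivAt_nonneg
    (f := fun x => x * Real.sinh x + 2 - 2 * Real.cosh x)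
    (f' := fun x => x * Real.cosh x - Real.sinh x)
    (by simp) (fun x => ?_) (fun x hx => sub_nonneg.2 (sinh_le_mul_cosh hx)) hy)
  refine ((((hasDerivAt_id x).mul (Real.hasDerivAt_sinh x)).add_const 2).sub
    ((Real.hasDerivAt_cosh x).const_mul 2)).congr_deriv ?_
  simp
  ring

lemma three_mul_sinh_le {y : ℝ} (hy : 0 ≤ y) :
    3 * Real.sinh y ≤ y * Real.cosh y + 2 * y := by
  refine sub_nonneg.1 (nonneg_of_hasDerivAt_nonneg
    (f := fun x => x * Real.cosh x + 2 * x - 3 * Real.sinh x)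
    (f' := fun x => x * Real.sinh x + 2 - 2 * Real.cosh x)
    (by simp) (fun x => ?_) (fun x hx => sub_nonneg.2 (two_mul_cosh_le hx)) hy)
  refine ((((hasDerivAt_id x).mul (Real.hasDerivAt_cosh x)).add
    ((hasDerivAt_id x).const_mul 2)).sub ((Real.hasDerivAt_sinh x).const_mul 3)).congr_deriv ?_
  simp
  ring

lemma sinh_sq_sub_sq_le {y : ℝ} (hy : 0 ≤ y) :
    3 * (Real.sinh y ^ 2 - y ^ 2) ≤ y ^ 2 * Real.sinh y ^ 2 := by
  refine sub_nonneg.1 (nonneg_of_hasDerivAt_nonneg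
    (f := fun x => x ^ 2 * Real.sinh x ^ 2 - 3 * (Real.sinh x ^ 2 - x ^ 2))
    (f' := fun x => 2 * (x * Real.sinh x ^ 2 + x ^ 2 * Real.sinh x * Real.cosh x
      - 3 * Real.sinh x * Real.cosh x + 3 * x))
    (by simp) (fun x => ?_) (fun x hx => ?_) hy)
  · refine (((hasDerivAt_pow 2 x).mul ((Real.hasDerivAt_sinh x).pow 2)).sub
      ((((Real.hasDerivAt_sinh x).pow 2).sub (hasDerivAt_pow 2 x)).const_mul 3)).congr_deriv ?_
    simp
    ring
  · have h1 := mul_le_mul_of_nonneg_right (mul_cosh_sub_sinh_le hx) (Real.cosh_pos x).le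
    have h2 := three_mul_sinh_le (mul_nonneg zero_le_two hx)
    rw [Real.sinh_two_mul, Real.cosh_two_mul] at h2
    have h3 := Real.cosh_sq x
    have h4 : x * Real.cosh x ^ 2 = x * Real.sinh x ^ 2 + x := by rw [h3]; ring
    nlinarith

lemma Lb_div_nonneg {β r : ℝ} (hβ : 0 < β) (hr : 0 < r) : 0 ≤ Lb β r / r := by
  have hy : 0 < β * r := mul_pos hβ hr
  have hs : 0 < Real.sinh (β * r) := Real.sinh_pos_iff.2 hy
  rw [Lb, if_neg hr.ne', coth]
  refine div_nonneg (sub_nonneg.2 ?_) hr.le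
  rw [div_le_div_iff₀ hy hs]
  linarith [sinh_le_mul_cosh hy.le]

lemma Lb_div_le {β r : ℝ} (hβ : 0 < β) (hr : 0 < r) : Lb β r / r ≤ β / 3 := by
  have hy : 0 < β * r := mul_pos hβ hr
  have hs : 0 < Real.sinh (β * r) := Real.sinh_pos_iff.2 hy
  rw [Lb, if_neg hr.ne', coth, div_le_iff₀ hr, div_sub_div _ _ hs.ne' hy.ne',
    div_le_iff₀ (mul_pos hs hy)]
  linarith [mul_cosh_sub_sinh_le hy.le]

lemma Lb'_nonneg {β r : ℝ} (hβ : 0 < β) (hr : 0 < r) : 0 ≤ Lb' β r := by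
  have hy : 0 < β * r := mul_pos hβ hr
  have hs : 0 < Real.sinh (β * r) := Real.sinh_pos_iff.2 hy
  have h := pow_le_pow_left₀ hy.le (Real.self_le_sinh_iff.2 hy.le) 2
  rw [Lb', sub_nonneg, div_le_div_iff₀ (by positivity) (by positivity)]
  linarith

lemma Lb'_le {β r : ℝ} (hβ : 0 < β) (hr : 0 < r) : Lb' β r ≤ β / 3 := by
  have hy : 0 < β * r := mul_pos hβ hr
  have hs : 0 < Real.sinh (β * r) := Real.sinh_pos_iff.2 hy
  rw [Lb', div_sub_div _ _ (by positivity) (by positivity), div_le_iff₀ (by positivity)]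
  linarith [sinh_sq_sub_sq_le hy.le]

lemma enorm3_sq (v : Fin 3 → ℝ) : enorm3 v ^ 2 = v 0 ^ 2 + v 1 ^ 2 + v 2 ^ 2 := by
  rw [enorm3, Real.sq_sqrt (Finset.sum_nonneg fun i _ => sq_nonneg (v i)), Fin.sum_univ_three]

lemma enorm3_nonneg (v : Fin 3 → ℝ) : 0 ≤ enorm3 v := Real.sqrt_nonneg _

lemma enorm3_pos {v : Fin 3 → ℝ} (hv : v ≠ 0) : 0 < enorm3 v := by
  obtain ⟨i, hi⟩ := Function.ne_iff.1 hv
  exact Real.sqrt_pos.2 (Finset.sum_pos' (fun j _ => sq_nonneg (v j))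
    ⟨i, Finset.mem_univ i, sq_pos_of_ne_zero hi⟩)

lemma sq_dotProduct_le (v w : Fin 3 → ℝ) : (v ⬝ᵥ w) ^ 2 ≤ enorm3 v ^ 2 * enorm3 w ^ 2 := by
  simp only [enorm3_sq, dotProduct, Fin.sum_univ_three]
  nlinarith [sq_nonneg (v 0 * w 1 - v 1 * w 0), sq_nonneg (v 0 * w 2 - v 2 * w 0),
    sq_nonneg (v 1 * w 2 - v 2 * w 1)]

/-- `F̃(ξ)` acts as `L'_β(‖ξ‖)` along `ξ` and as `L_β(‖ξ‖)/‖ξ‖` on its orthogonal complement. -/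
lemma enorm3_Ftilde_mulVec_sq (β : ℝ) {ξ : Fin 3 → ℝ} (hξ : ξ ≠ 0) (x : Fin 3 → ℝ) :
    enorm3 ((Ftilde β ξ).mulVec x) ^ 2 =
      (Lb β (enorm3 ξ) / enorm3 ξ) ^ 2 * (enorm3 x ^ 2 - (ξ ⬝ᵥ x) ^ 2 / enorm3 ξ ^ 2)
        + Lb' β (enorm3 ξ) ^ 2 * ((ξ ⬝ᵥ x) ^ 2 / enorm3 ξ ^ 2) := by
  have hr := (enorm3_pos hξ).ne'
  have hr2 := enorm3_sq ξ
  have happly (i : Fin 3) : (Ftilde β ξ).mulVec x i =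
      (Lb' β (enorm3 ξ) - Lb β (enorm3 ξ) / enorm3 ξ) * ((ξ ⬝ᵥ x) / enorm3 ξ ^ 2) * ξ i
        + Lb β (enorm3 ξ) / enorm3 ξ * x i := by
    rw [Ftilde, if_neg hξ, add_mulVec, smul_mulVec, smul_mulVec, one_mulVec]
    simp only [mulVec, dotProduct, Pi.add_apply, Pi.smul_apply, of_apply, smul_eq_mul,
      Fin.sum_univ_three]
    field_simp
  have hd : ξ ⬝ᵥ x = ξ 0 * x 0 + ξ 1 * x 1 + ξ 2 * x 2 := by
    simp [dotProduct, Fin.sum_univ_three]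
  rw [enorm3_sq ((Ftilde β ξ).mulVec x), happly, happly, happly, enorm3_sq x]
  generalize Lb β (enorm3 ξ) / enorm3 ξ = c
  generalize Lb' β (enorm3 ξ) = a
  generalize ξ ⬝ᵥ x = d at *
  generalize enorm3 ξ = r at *
  have hsum : ∀ k : ℝ, (k * ξ 0 + c * x 0) ^ 2 + (k * ξ 1 + c * x 1) ^ 2
      + (k * ξ 2 + c * x 2) ^ 2
      = k ^ 2 * r ^ 2 + 2 * k * c * d + c ^ 2 * (x 0 ^ 2 + x 1 ^ 2 + x 2 ^ 2) := by
    intro k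
    rw [hr2, hd]
    ring
  rw [hsum]
  field_simp
  ring

/-- Uniform bound: for every `β > 0`, `ξ ≠ 0`, and every `x ∈ ℝ³`,
`‖F̃(ξ) x‖ ≤ (β/3)·‖x‖` in the Euclidean norm. -/
theorem Ftilde_bound (β : ℝ) (hβ : 0 < β) (ξ : Fin 3 → ℝ) (hξ : ξ ≠ 0) (x : Fin 3 → ℝ) :
    enorm3 ((Ftilde β ξ).mulVec x) ≤ β / 3 * enorm3 x := by
  have hr := enorm3_pos hξ
  refine (abs_le_of_sq_le_sq' ?_ (mul_nonneg (by positivity) (enorm3_nonneg x))).2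
  rw [enorm3_Ftilde_mulVec_sq β hξ x, mul_pow]
  have hc := pow_le_pow_left₀ (Lb_div_nonneg hβ hr) (Lb_div_le hβ hr) 2
  have ha := pow_le_pow_left₀ (Lb'_nonneg hβ hr) (Lb'_le hβ hr) 2
  have ht0 : 0 ≤ (ξ ⬝ᵥ x) ^ 2 / enorm3 ξ ^ 2 := by positivity
  have ht : (ξ ⬝ᵥ x) ^ 2 / enorm3 ξ ^ 2 ≤ enorm3 x ^ 2 := by
    rw [div_le_iff₀ (by positivity), mul_comm]
    exact sq_dotProduct_le ξ x
  linarith [mul_le_mul_of_nonneg_right hc (sub_nonneg.2 ht),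
    mul_le_mul_of_nonneg_right ha ht0]
end

section
/- Let β > 0, let S ⊂ ℝ³ be a bounded Lebesgue-measurable set with positive Lebesgue measure, and let w ∈ ℝ³ with w ≠ 0. Then the integral over S of the function ξ ↦ wᵀ F̃(ξ) w (defined for ξ ≠ 0, with arbitrary value at ξ = 0) with respect to Lebesgue measure is strictly positive: ∫_S wᵀ F̃(ξ) w dξ > 0. -/
open MeasureTheory Filter Matrix
open scoped Topology

theorem sinh_lt_mul_cosh {y : ℝ} (hy : 0 < y) : Real.sinh y < y * Real.cosh y := by
  have hmono : StrictMonoOn (fun x : ℝ => x * Real.cosh x - Real.sinh x) (Set.Ici 0) := by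
    refine strictMonoOn_of_deriv_pos (convex_Ici 0) (by fun_prop) fun x hx => ?_
    rw [interior_Ici] at hx
    have h : HasDerivAt (fun x : ℝ => x * Real.cosh x - Real.sinh x)
        (1 * Real.cosh x + x * Real.sinh x - Real.cosh x) x :=
      ((hasDerivAt_id x).mul (Real.hasDerivAt_cosh x)).sub (Real.hasDerivAt_sinh x)
    rw [h.deriv]
    have := mul_pos hx (Real.sinh_pos_iff.2 hx)
    linarith
  have := hmono Set.self_mem_Ici hy.le hy
  simp only [Real.sinh_zero, zero_mul, sub_zero] at this
  linarith

theorem mul_cosh_lt_one_add_sq_mul_sinh {y : ℝ} (hy : 0 < y) :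
    y * Real.cosh y < (1 + y ^ 2) * Real.sinh y := by
  have hmono : StrictMonoOn (fun x : ℝ => (1 + x ^ 2) * Real.sinh x - x * Real.cosh x)
      (Set.Ici 0) := by
    refine strictMonoOn_of_deriv_pos (convex_Ici 0) (by fun_prop) fun x hx => ?_
    rw [interior_Ici] at hx
    have h : HasDerivAt (fun x : ℝ => (1 + x ^ 2) * Real.sinh x - x * Real.cosh x)
        ((2 * x) * Real.sinh x + (1 + x ^ 2) * Real.cosh x
          - (1 * Real.cosh x + x * Real.sinh x)) x := by
      have hsq : HasDerivAt (fun x : ℝ => 1 + x ^ 2) (2 * x) x := by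
        simpa using (hasDerivAt_pow 2 x).const_add 1
      exact (hsq.mul (Real.hasDerivAt_sinh x)).sub
        ((hasDerivAt_id x).mul (Real.hasDerivAt_cosh x))
    rw [h.deriv]
    have h₁ := mul_pos hx (Real.sinh_pos_iff.2 hx)
    have h₂ := mul_pos (pow_pos hx 2) (Real.cosh_pos x)
    linarith
  have := hmono Set.self_mem_Ici hy.le hy
  simp only [Real.sinh_zero, mul_zero, zero_mul, sub_zero] at this
  linarith

theorem Lb_pos {β z : ℝ} (hβ : 0 < β) (hz : 0 < z) : 0 < Lb β z := by
  have hy := mul_pos hβ hz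
  have hs := Real.sinh_pos_iff.2 hy
  rw [Lb, if_neg hz.ne', coth, sub_pos, div_lt_div_iff₀ hy hs]
  linarith [sinh_lt_mul_cosh hy]

theorem Lb_div_self_le {β z : ℝ} (hβ : 0 < β) (hz : 0 < z) : Lb β z / z ≤ β := by
  have hy := mul_pos hβ hz
  have hs := Real.sinh_pos_iff.2 hy
  rw [div_le_iff₀ hz, Lb, if_neg hz.ne', coth, sub_le_iff_le_add, div_le_iff₀ hs]
  have h : (β * z + 1 / (β * z)) * Real.sinh (β * z)
      = (1 + (β * z) ^ 2) * Real.sinh (β * z) / (β * z) := by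
    field_simp
    ring
  rw [h, le_div_iff₀ hy]
  linarith [mul_cosh_lt_one_add_sq_mul_sinh hy]

theorem Lb'_eq {β z : ℝ} (hβ : 0 < β) :
    Lb' β z = β * (1 / (β * z) ^ 2 - 1 / Real.sinh (β * z) ^ 2) := by
  rw [Lb', mul_sub, mul_one_div, mul_one_div, mul_pow]
  congr 1
  field_simp

theorem Lb'_pos {β z : ℝ} (hβ : 0 < β) (hz : 0 < z) : 0 < Lb' β z := by
  have hy := mul_pos hβ hz
  rw [Lb'_eq hβ]
  refine mul_pos hβ (sub_pos.2 (one_div_lt_one_div_of_lt (pow_pos hy 2) ?_))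
  exact pow_lt_pow_left₀ (Real.self_lt_sinh_iff.2 hy) hy.le two_ne_zero

theorem Lb'_le_s10 {β z : ℝ} (hβ : 0 < β) (hz : 0 < z) : Lb' β z ≤ β := by
  have hy := mul_pos hβ hz
  have hs := Real.sinh_pos_iff.2 hy
  rw [Lb'_eq hβ]
  refine mul_le_of_le_one_right hβ.le ?_
  have h := pow_le_pow_left₀ hs.le (sinh_lt_mul_cosh hy).le 2
  rw [mul_pow, Real.cosh_sq] at h
  rw [div_sub_div _ _ (pow_pos hy 2).ne' (pow_pos hs 2).ne',
    div_le_one (mul_pos (pow_pos hy 2) (pow_pos hs 2))]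
  linarith

theorem measurable_Lb (β : ℝ) : Measurable (Lb β) := by
  unfold Lb coth
  exact Measurable.ite (measurableSet_singleton 0) measurable_const (by fun_prop)

theorem measurable_Lb' (β : ℝ) : Measurable (Lb' β) := by
  unfold Lb'
  fun_prop

theorem measurable_enorm3 : Measurable enorm3 := by
  unfold enorm3
  fun_prop

theorem enorm3_pos_s10 {ξ : Fin 3 → ℝ} (hξ : ξ ≠ 0) : 0 < enorm3 ξ := by
  obtain ⟨i, hi⟩ := Function.ne_iff.1 hξ
  exact Real.sqrt_pos.2 (Finset.sum_pos' (fun j _ => sq_nonneg _)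
    ⟨i, Finset.mem_univ i, sq_pos_of_ne_zero hi⟩)

theorem enorm3_sq_s10 (ξ : Fin 3 → ℝ) : enorm3 ξ ^ 2 = ∑ i, ξ i ^ 2 :=
  Real.sq_sqrt (Finset.sum_nonneg fun _ _ => sq_nonneg _)

/-- The quadratic form of `F̃(ξ)`, split along the direction of `ξ` and its orthogonal
complement. -/
theorem dotProduct_Ftilde_mulVec {β : ℝ} {ξ : Fin 3 → ℝ} (hξ : ξ ≠ 0) (w : Fin 3 → ℝ) :
    w ⬝ᵥ (Ftilde β ξ).mulVec w =
      Lb' β (enorm3 ξ) * ((w ⬝ᵥ ξ) ^ 2 / enorm3 ξ ^ 2)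
        + Lb β (enorm3 ξ) / enorm3 ξ * (enorm3 w ^ 2 - (w ⬝ᵥ ξ) ^ 2 / enorm3 ξ ^ 2) := by
  have hr := (enorm3_pos_s10 hξ).ne'
  have hrank : w ⬝ᵥ (Matrix.of fun i j => ξ i * ξ j).mulVec w = (w ⬝ᵥ ξ) ^ 2 := by
    simp only [dotProduct, mulVec, Fin.sum_univ_three, Matrix.of_apply]
    ring
  have hone : w ⬝ᵥ w = enorm3 w ^ 2 := by
    rw [enorm3_sq_s10]
    simp only [dotProduct, sq]
  rw [Ftilde, if_neg hξ, add_mulVec, dotProduct_add, smul_mulVec, smul_mulVec, dotProduct_smul,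
    dotProduct_smul, one_mulVec, hrank, hone, smul_eq_mul, smul_eq_mul]
  field_simp
  ring

theorem dotProduct_sq_div_le {ξ : Fin 3 → ℝ} (hξ : ξ ≠ 0) (w : Fin 3 → ℝ) :
    (w ⬝ᵥ ξ) ^ 2 / enorm3 ξ ^ 2 ≤ enorm3 w ^ 2 := by
  rw [div_le_iff₀ (pow_pos (enorm3_pos_s10 hξ) 2), enorm3_sq_s10, enorm3_sq_s10]
  exact Finset.sum_mul_sq_le_sq_mul_sq _ _ _

theorem dotProduct_Ftilde_mulVec_pos {β : ℝ} (hβ : 0 < β) {ξ w : Fin 3 → ℝ} (hξ : ξ ≠ 0)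
    (hw : w ≠ 0) : 0 < w ⬝ᵥ (Ftilde β ξ).mulVec w := by
  have hr := enorm3_pos_s10 hξ
  have hL := div_pos (Lb_pos hβ hr) hr
  have hL' := Lb'_pos hβ hr
  have ha : 0 ≤ (w ⬝ᵥ ξ) ^ 2 / enorm3 ξ ^ 2 := by positivity
  rw [dotProduct_Ftilde_mulVec hξ]
  rcases (dotProduct_sq_div_le hξ w).eq_or_lt with h | h
  · rw [h, sub_self, mul_zero, add_zero]
    exact mul_pos hL' (pow_pos (enorm3_pos_s10 hw) 2)
  · exact add_pos_of_nonneg_of_pos (mul_nonneg hL'.le ha) (mul_pos hL (sub_pos.2 h))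

theorem dotProduct_Ftilde_mulVec_le {β : ℝ} (hβ : 0 < β) {ξ : Fin 3 → ℝ} (hξ : ξ ≠ 0)
    (w : Fin 3 → ℝ) : w ⬝ᵥ (Ftilde β ξ).mulVec w ≤ β * enorm3 w ^ 2 := by
  have hr := enorm3_pos_s10 hξ
  have ha : 0 ≤ (w ⬝ᵥ ξ) ^ 2 / enorm3 ξ ^ 2 := by positivity
  rw [dotProduct_Ftilde_mulVec hξ]
  have h₁ := mul_le_mul_of_nonneg_right (Lb'_le_s10 hβ hr) ha
  have h₂ := mul_le_mul_of_nonneg_right (Lb_div_self_le hβ hr)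
    (sub_nonneg.2 (dotProduct_sq_div_le hξ w))
  linarith

/-- For `β > 0`, a bounded measurable set `S ⊂ ℝ³` of positive Lebesgue measure, and `w ≠ 0`,
the integral over `S` of `ξ ↦ wᵀ F̃(ξ) w` (with arbitrary value at `ξ = 0`) is strictly
positive. -/
theorem integral_quadratic_form_pos (β : ℝ) (hβ : 0 < β) (S : Set (Fin 3 → ℝ))
    (hSb : Bornology.IsBounded S) (hSm : MeasurableSet S) (hSpos : 0 < volume S)
    (w : Fin 3 → ℝ) (hw : w ≠ 0)
    (F : (Fin 3 → ℝ) → Matrix (Fin 3) (Fin 3) ℝ) (hF : ∀ ξ, ξ ≠ 0 → F ξ = Ftilde β ξ) :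
    0 < ∫ ξ in S, w ⬝ᵥ (F ξ).mulVec w := by
  have hne : ∀ᵐ ξ ∂(volume.restrict S), ξ ≠ (0 : Fin 3 → ℝ) :=
    ae_restrict_of_ae (Measure.ae_ne volume 0)
  have hpos : ∀ ξ, ξ ≠ 0 → 0 < w ⬝ᵥ (F ξ).mulVec w := fun ξ hξ => by
    rw [hF ξ hξ]
    exact dotProduct_Ftilde_mulVec_pos hβ hξ hw
  have hmeas : AEStronglyMeasurable (fun ξ => w ⬝ᵥ (F ξ).mulVec w) (volume.restrict S) := by
    have hm : Measurable fun ξ : Fin 3 → ℝ =>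
        Lb' β (enorm3 ξ) * ((w ⬝ᵥ ξ) ^ 2 / enorm3 ξ ^ 2)
          + Lb β (enorm3 ξ) / enorm3 ξ * (enorm3 w ^ 2 - (w ⬝ᵥ ξ) ^ 2 / enorm3 ξ ^ 2) := by
      have h₁ := (measurable_Lb β).comp measurable_enorm3
      have h₂ := (measurable_Lb' β).comp measurable_enorm3
      have h₃ := measurable_enorm3
      have h₄ : Measurable fun ξ : Fin 3 → ℝ => w ⬝ᵥ ξ := by
        unfold dotProduct
        fun_prop
      exact (h₂.mul ((h₄.pow_const 2).div (h₃.pow_const 2))).add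
        ((h₁.div h₃).mul (((h₄.pow_const 2).div (h₃.pow_const 2)).const_sub _))
    refine hm.aestronglyMeasurable.congr ?_
    filter_upwards [hne] with ξ hξ
    rw [hF ξ hξ, dotProduct_Ftilde_mulVec hξ]
  have hint : IntegrableOn (fun ξ => w ⬝ᵥ (F ξ).mulVec w) S volume := by
    refine IntegrableOn.of_bound hSb.measure_lt_top hmeas (β * enorm3 w ^ 2) ?_
    filter_upwards [hne] with ξ hξ
    rw [Real.norm_of_nonneg (hpos ξ hξ).le, hF ξ hξ]
    exact dotProduct_Ftilde_mulVec_le hβ hξ w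
  rw [integral_pos_iff_support_of_nonneg_ae (hne.mono fun ξ hξ => (hpos ξ hξ).le) hint]
  refine (hSpos.trans_eq (Measure.restrict_apply_univ S).symm).trans_le (measure_mono_ae ?_)
  filter_upwards [hne] with ξ hξ _ using (hpos ξ hξ).ne'
end
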